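/- Let x and x' be indices with 1 < x, x' ≤ n, BWT[x] ≠ BWT[x-1] and BWT[x'] ≠ BWT[x'-1], let c ∈ {BWT[x], BWT[x-1]} and c' ∈ {BWT[x'], BWT[x'-1]}, and set ℓ := Candt_c(b(x), e(x)) and ℓ' := Candt_{c'}(b(x'), e(x')). If ℓ ≠ ℓ' and w(ℓ) ≤ w(ℓ'), then the string T[n-SA[ℓ]+1-w(ℓ)..n-SA[ℓ]+1] is not a suffix of the string T[n-SA[ℓ']+1-w(ℓ')..n-SA[ℓ']+1]. -/

import Mathlib

open scoped Classical

/-- `seg T i len` is the string `T[i..i+len-1]`. -/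
def seg (T : ℕ → ℤ) (i len : ℕ) : List ℤ :=
  (List.range len).map fun k => T (i + k)

/-- `sfx T n p` is the suffix `T[p..n]` of a length-`n` text. -/
def sfx (T : ℕ → ℤ) (n p : ℕ) : List ℤ := seg T p (n + 1 - p)

/-- The reversed text: `Trev T n n = T n` and `Trev T n i = T (n - i)` for `i < n`. -/
def Trev (T : ℕ → ℤ) (n : ℕ) : ℕ → ℤ := fun i => if i = n then T n else T (n - i)

/-- Length of the longest common prefix of two strings. -/
def lcpLen : List ℤ → List ℤ → ℕ
  | a :: l₁, b :: l₂ => if a = b then lcpLen l₁ l₂ + 1 else 0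
  | _, _ => 0

/-- `s` occurs as a substring of `T[1..n]`. -/
def OccursIn (T : ℕ → ℤ) (n : ℕ) (s : List ℤ) : Prop :=
  ∃ i : ℕ, 1 ≤ i ∧ i + s.length ≤ n + 1 ∧ s = seg T i s.length

/-- `s` is a right-maximal substring of `T[1..n]` over the alphabet `{1,…,σ}`. -/
def RightMax (T : ℕ → ℤ) (n σ : ℕ) (s : List ℤ) : Prop :=
  ∃ a b : ℤ, a ≠ b ∧ 1 ≤ a ∧ a ≤ (σ : ℤ) ∧ 1 ≤ b ∧ b ≤ (σ : ℤ) ∧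
    OccursIn T n (s ++ [a]) ∧ OccursIn T n (s ++ [b])

/-- `X` is a suffixient set for `T[1..n]`. -/
def Suffixient (T : ℕ → ℤ) (n σ : ℕ) (X : Set ℕ) : Prop :=
  ∀ s : List ℤ, RightMax T n σ s → ∀ c : ℤ, 1 ≤ c → c ≤ (σ : ℤ) →
    OccursIn T n (s ++ [c]) → ∃ x ∈ X, (s ++ [c]) <:+ seg T 1 x

def StartRun (BWT : ℕ → ℤ) (x : ℕ) : Prop := 1 < x ∧ BWT x ≠ BWT (x - 1)

def EndRun (BWT : ℕ → ℤ) (n x : ℕ) : Prop := x < n ∧ BWT x ≠ BWT (x + 1)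

def RunBoundary (BWT : ℕ → ℤ) (n x : ℕ) : Prop := StartRun BWT x ∨ EndRun BWT n x

/-- `bIdx L x` : the largest index `y < x` with `L y < L x`, or `1` if none exists. -/
noncomputable def bIdx (L : ℕ → ℤ) (x : ℕ) : ℕ :=
  sSup {y : ℕ | (1 ≤ y ∧ y < x ∧ L y < L x) ∨ y = 1}

/-- `eIdx L n x` : the smallest index `y > x` with `L y < L x`, or `n+1` if none exists. -/
noncomputable def eIdx (L : ℕ → ℤ) (n x : ℕ) : ℕ :=
  sInf {y : ℕ | (x < y ∧ y ≤ n ∧ L y < L x) ∨ y = n + 1}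

/-- The maximal weight `w y` over indices `a ≤ y < a'` with `BWT y = c` and `w y ≥ 0`. -/
noncomputable def wMax (BWT w : ℕ → ℤ) (c : ℤ) (a a' : ℕ) : ℤ :=
  (sSup {m : ℕ | ∃ q : ℕ, a ≤ q ∧ q < a' ∧ BWT q = c ∧ 0 ≤ w q ∧ (m : ℤ) = w q} : ℕ)

/-- `Candt BWT w c a a'`: the smallest index `a ≤ p < a'` with `BWT p = c` whose weight
attains the maximum weight among such indices; `-1` if no index
`a ≤ y < a'` with `BWT y = c` and `w y ≥ 0` exists. -/
noncomputable def Candt (BWT w : ℕ → ℤ) (c : ℤ) (a a' : ℕ) : ℤ :=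
  if ∃ p : ℕ, a ≤ p ∧ p < a' ∧ BWT p = c ∧ 0 ≤ w p then
    ((sInf {p : ℕ | a ≤ p ∧ p < a' ∧ BWT p = c ∧ w p = wMax BWT w c a a'} : ℕ) : ℤ)
  else -1

def FullL (n : ℕ) (SA : ℕ → ℕ) (BWT LCP w : ℕ → ℤ) : Set ℕ :=
  { q | ∃ x : ℕ, 1 < x ∧ x ≤ n ∧ BWT x ≠ BWT (x - 1) ∧
      ∃ c : ℤ, (c = BWT x ∨ c = BWT (x - 1)) ∧
      ∃ p : ℕ, (p : ℤ) = Candt BWT w c (bIdx LCP x) (eIdx LCP n x) ∧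
        q = n - SA p + 1 }

/-- Basic assumptions on the text `T[1..n]` over alphabet `{1,…,σ}` with sentinel `dollar`. -/
structure TextSetup (n σ : ℕ) (T : ℕ → ℤ) (dollar : ℤ) : Prop where
  hn : 2 ≤ n
  hsigma : 2 ≤ σ
  hsigma_le : σ ≤ n
  hT : ∀ i, 1 ≤ i → i ≤ n → 1 ≤ T i ∧ T i ≤ (σ : ℤ)
  hTn : T n = dollar
  hTne : ∀ i, 1 ≤ i → i < n → T i ≠ dollar

/-- `SA[1..n]` is the suffix array of the reversed text. -/
structure SASetup (n σ : ℕ) (T : ℕ → ℤ) (dollar : ℤ) (SA : ℕ → ℕ)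
    extends TextSetup n σ T dollar : Prop where
  hSAmem : ∀ i, 1 ≤ i → i ≤ n → 1 ≤ SA i ∧ SA i ≤ n
  hSAinj : ∀ i j, 1 ≤ i → i ≤ n → 1 ≤ j → j ≤ n → SA i = SA j → i = j
  hSAsurj : ∀ p, 1 ≤ p → p ≤ n → ∃ i, 1 ≤ i ∧ i ≤ n ∧ SA i = p
  hSAord : ∀ i j, 1 ≤ i → i < j → j ≤ n →
    List.Lex (· < ·) (sfx (Trev T n) n (SA i)) (sfx (Trev T n) n (SA j))

/-- `LCP[1..n]` is the LCP array of the reversed text. -/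
structure LCPSetup (n σ : ℕ) (T : ℕ → ℤ) (dollar : ℤ) (SA : ℕ → ℕ) (LCP : ℕ → ℤ)
    extends SASetup n σ T dollar SA : Prop where
  hLCP1 : LCP 1 = -1
  hLCP : ∀ i, 1 < i → i ≤ n →
    LCP i = (lcpLen (sfx (Trev T n) n (SA (i - 1))) (sfx (Trev T n) n (SA i)) : ℤ)
  hLCPend : LCP (n + 1) = -1

/-- Additionally, `BWT[1..n]` is the BWT of the reversed text and `w` is the weight function. -/
structure FullSetup (n σ : ℕ) (T : ℕ → ℤ) (dollar : ℤ) (SA : ℕ → ℕ)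
    (BWT LCP w : ℕ → ℤ) extends LCPSetup n σ T dollar SA LCP : Prop where
  hBWT : ∀ i, 1 ≤ i → i ≤ n → BWT i = T (n - SA i + 1)
  hBWTend : BWT (n + 1) = -1
  hwNot : ∀ x, 1 ≤ x → x ≤ n → ¬ RunBoundary BWT n x → w x = -1
  hwRB : ∀ x, 1 ≤ x → x ≤ n → RunBoundary BWT n x →
    (∃ s : List ℤ, RightMax T n σ s ∧ s <:+ seg T 1 (n - SA x)) →
    IsGreatest {m : ℤ | ∃ s : List ℤ, RightMax T n σ s ∧ s <:+ seg T 1 (n - SA x) ∧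
      m = (s.length : ℤ)} (w x)

/-- `sIdx`: the minimum index `i ∈ [1..n]` such that `T[n-SA[ℓ]+1-w(ℓ)..n-SA[ℓ]]`
is a suffix of `T[1..n-SA[i]]`. -/
noncomputable def sIdx (T : ℕ → ℤ) (n : ℕ) (SA : ℕ → ℕ) (w : ℕ → ℤ) (l : ℕ) : ℕ :=
  sInf {i : ℕ | 1 ≤ i ∧ i ≤ n ∧
    seg T (n - SA l + 1 - (w l).toNat) (w l).toNat <:+ seg T 1 (n - SA i)}

/-- `tIdx`: the maximum such index. -/
noncomputable def tIdx (T : ℕ → ℤ) (n : ℕ) (SA : ℕ → ℕ) (w : ℕ → ℤ) (l : ℕ) : ℕ :=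
  sSup {i : ℕ | 1 ≤ i ∧ i ≤ n ∧
    seg T (n - SA l + 1 - (w l).toNat) (w l).toNat <:+ seg T 1 (n - SA i)}

/-- `pIdx c i`: the largest index `j < i` with `w j > -1` and `BWT j = c`, or `0`. -/
noncomputable def pIdx (BWT w : ℕ → ℤ) (c : ℤ) (i : ℕ) : ℕ :=
  sSup {j : ℕ | (1 ≤ j ∧ j < i ∧ -1 < w j ∧ BWT j = c) ∨ j = 0}

/-- `pW c i`: the weight of `pIdx c i`, or `-1` if no index as in `pIdx` exists. -/
noncomputable def pW (BWT w : ℕ → ℤ) (c : ℤ) (i : ℕ) : ℤ :=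
  if ∃ j : ℕ, 1 ≤ j ∧ j < i ∧ -1 < w j ∧ BWT j = c then w (pIdx BWT w c i) else -1

/-- `α` is colexicographically smaller than `β`. -/
def ColexLt (α β : List ℤ) : Prop :=
  (α ≠ β ∧ α <:+ β) ∨
  ∃ k : ℕ, 1 ≤ k ∧ k ≤ α.length ∧ k ≤ β.length ∧
    (∀ i, 1 ≤ i → i < k → α.getD (α.length - i) 0 = β.getD (β.length - i) 0) ∧
    α.getD (α.length - k) 0 < β.getD (β.length - k) 0

lemma seg_succ (T : ℕ → ℤ) (i m : ℕ) : seg T i (m + 1) = seg T i m ++ [T (i + m)] := by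
  simp [seg, List.range_succ]

lemma seg_length (T : ℕ → ℤ) (i m : ℕ) : (seg T i m).length = m := by
  simp [seg]

lemma seg_add (T : ℕ → ℤ) (i a b : ℕ) : seg T i (a + b) = seg T i a ++ seg T (i + a) b := by
  simp [seg, List.range_add, Function.comp_def, add_assoc]

lemma seg_suffix (T : ℕ → ℤ) {m N : ℕ} (h : m ≤ N) : seg T (N + 1 - m) m <:+ seg T 1 N := by
  obtain ⟨a, rfl⟩ := Nat.exists_eq_add_of_le' h
  rw [seg_add, show a + m + 1 - m = 1 + a by omega]
  exact List.suffix_append _ _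

lemma lcpLen_spec (A B : List ℤ) : ∃ v : List ℤ, v.length = lcpLen A B ∧ v <+: A ∧ v <+: B := by
  induction A generalizing B with
  | nil => exact ⟨[], by simp [lcpLen]⟩
  | cons a A ih =>
    cases B with
    | nil => exact ⟨[], by simp [lcpLen]⟩
    | cons b B =>
      by_cases hab : a = b
      · obtain ⟨v, hv, hA, hB⟩ := ih B
        subst hab
        exact ⟨a :: v, by simp [lcpLen, hv], by simpa using hA, by simpa using hB⟩
      · exact ⟨[], by simp [lcpLen, hab]⟩

lemma length_le_lcpLen {v A B : List ℤ} (hA : v <+: A) (hB : v <+: B) :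
    v.length ≤ lcpLen A B := by
  obtain ⟨A, rfl⟩ := hA
  obtain ⟨B, rfl⟩ := hB
  induction v with
  | nil => simp
  | cons a v ih => simpa [lcpLen] using ih

/-- The strings having a given prefix form a lexicographic interval. -/
lemma prefix_of_lex_between {v A B C : List ℤ} (hAB : A = B ∨ List.Lex (· < ·) A B)
    (hBC : B = C ∨ List.Lex (· < ·) B C) (hA : v <+: A) (hC : v <+: C) : v <+: B := by
  induction v generalizing A B C with
  | nil => simp
  | cons a v ih =>
    obtain ⟨A, rfl⟩ := hA
    obtain ⟨C, rfl⟩ := hC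
    cases B with
    | nil => simp at hAB
    | cons b B =>
      simp only [List.cons_append, List.cons.injEq, List.cons_lex_cons_iff] at hAB hBC
      have hab : a = b := by omega
      subst hab
      simp only [List.cons_prefix_cons, true_and]
      exact ih (A := v ++ A) (C := v ++ C) (by simpa using hAB) (by simpa using hBC)
        (List.prefix_append _ _) (List.prefix_append _ _)

/-- A suffix of the reversed text is a reversed prefix of the text followed by the sentinel. -/
lemma sfx_Trev (T : ℕ → ℤ) {n p : ℕ} (hp : p ≤ n) :
    sfx (Trev T n) n p = (seg T 1 (n - p)).reverse ++ [T n] := by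
  obtain ⟨k, rfl⟩ := Nat.exists_eq_add_of_le hp
  induction k generalizing p with
  | zero => simp [sfx, seg, Trev]
  | succ k ih =>
    have h := ih (p := p + 1) (by omega)
    rw [show p + 1 + k = p + (k + 1) by omega] at h
    have hs : sfx (Trev T (p + (k + 1))) (p + (k + 1)) p
        = Trev T (p + (k + 1)) p :: sfx (Trev T (p + (k + 1))) (p + (k + 1)) (p + 1) := by
      rw [sfx, sfx, show p + (k + 1) + 1 - p = 1 + (k + 1) by omega,
        show p + (k + 1) + 1 - (p + 1) = k + 1 by omega, seg_add]
      simp [seg]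
    rw [hs, h, show p + (k + 1) - p = k + 1 by omega,
      show p + (k + 1) - (p + 1) = k by omega, seg_succ]
    simp [Trev, show 1 + k = k + 1 by omega]

lemma prefix_left_of_prefix_concat {v A B : List ℤ} {d : ℤ} (hA : v <+: A ++ [d]) (hB : v <+: B ++ [d])
    (hdB : d ∉ B) (hne : A ≠ B) : v <+: A := by
  rcases List.prefix_concat_iff.1 hA with rfl | h
  · rcases List.prefix_concat_iff.1 hB with h | h
    · exact absurd (by simpa using h) hne
    · exact absurd (h.subset (by simp)) hdB
  · exact h

lemma concat_suffix_concat {s t : List ℤ} {a b : ℤ} (h : s ++ [a] <:+ t ++ [b]) :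
    a = b ∧ s <:+ t := by
  rw [← List.reverse_prefix] at h
  simpa using h

lemma OccursIn_of_suffix {T : ℕ → ℤ} {n N : ℕ} {s : List ℤ} (hN : N < n)
    (h : s <:+ seg T 1 N) : OccursIn T n (s ++ [T (N + 1)]) := by
  have hle : s.length ≤ N := by simpa [seg_length] using h.length_le
  have hs : s = seg T (N + 1 - s.length) s.length :=
    (List.suffix_of_suffix_length_le h (seg_suffix T hle) (by simp [seg_length])).eq_of_length
      (by simp [seg_length])
  refine ⟨N + 1 - s.length, by omega, by simp; omega, ?_⟩
  rw [List.length_append, List.length_singleton, seg_succ, ← hs,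
    show N + 1 - s.length + s.length = N + 1 by omega]

lemma bIdx_spec (L : ℕ → ℤ) {x : ℕ} (hx : 1 < x) (h1 : L 1 < L x) :
    1 ≤ bIdx L x ∧ bIdx L x < x ∧ L (bIdx L x) < L x ∧
      ∀ y, bIdx L x < y → y < x → L x ≤ L y := by
  have hbdd : BddAbove {y : ℕ | (1 ≤ y ∧ y < x ∧ L y < L x) ∨ y = 1} :=
    ⟨x, by rintro y (h | h) <;> omega⟩
  have hmem := Nat.sSup_mem ⟨1, Or.inr rfl⟩ hbdd
  have hge : 1 ≤ bIdx L x := le_csSup hbdd (Or.inr rfl)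
  change _ ∨ bIdx L x = 1 at hmem
  refine ⟨hge, ?_, ?_, fun y hy hyx => ?_⟩
  · rcases hmem with h | h
    · exact h.2.1
    · omega
  · rcases hmem with h | h
    · exact h.2.2
    · rwa [h]
  · by_contra! hlt
    have : y ≤ bIdx L x := le_csSup hbdd (Or.inl ⟨by omega, hyx, hlt⟩)
    omega

lemma eIdx_spec (L : ℕ → ℤ) {n x : ℕ} (hx : x ≤ n) :
    x < eIdx L n x ∧ eIdx L n x ≤ n + 1 ∧ (eIdx L n x ≤ n → L (eIdx L n x) < L x) ∧
      ∀ y, x < y → y < eIdx L n x → L x ≤ L y := by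
  have hmem : eIdx L n x ∈ {y : ℕ | (x < y ∧ y ≤ n ∧ L y < L x) ∨ y = n + 1} :=
    Nat.sInf_mem ⟨n + 1, Or.inr rfl⟩
  have hle : eIdx L n x ≤ n + 1 := Nat.sInf_le (Or.inr rfl)
  refine ⟨?_, hle, fun h => ?_, fun y hy hye => ?_⟩
  · rcases hmem with h | h <;> omega
  · rcases hmem with h' | h'
    · exact h'.2.2
    · omega
  · by_contra! hlt
    have : eIdx L n x ≤ y := Nat.sInf_le (Or.inl ⟨hy, by omega, hlt⟩)
    omega

lemma Candt_spec {BWT w : ℕ → ℤ} {c : ℤ} {a a' l : ℕ} (h : (l : ℤ) = Candt BWT w c a a') :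
    a ≤ l ∧ l < a' ∧ BWT l = c ∧ 0 ≤ w l ∧
      ∀ q, a ≤ q → q < a' → BWT q = c → w q ≤ w l ∧ (w q = w l → l ≤ q) := by
  unfold Candt at h
  split_ifs at h with hex
  obtain ⟨p, hp, hp', hpc, hpw⟩ := hex
  have hfin : {m : ℕ | ∃ q : ℕ, a ≤ q ∧ q < a' ∧ BWT q = c ∧ 0 ≤ w q ∧ (m : ℤ) = w q}.Finite := by
    refine ((Set.finite_Iio a').image fun q => (w q).toNat).subset ?_
    rintro m ⟨q, -, hq, -, -, hm⟩
    exact ⟨q, hq, by simp [← hm]⟩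
  obtain ⟨q, hq, hq', hqc, -, hqm⟩ :=
    Nat.sSup_mem (s := {m : ℕ | ∃ q : ℕ, a ≤ q ∧ q < a' ∧ BWT q = c ∧ 0 ≤ w q ∧ (m : ℤ) = w q})
      ⟨(w p).toNat, p, hp, hp', hpc, hpw, by omega⟩ hfin.bddAbove
  obtain rfl := Nat.cast_injective h
  have hmem := Nat.sInf_mem (s := {p : ℕ | a ≤ p ∧ p < a' ∧ BWT p = c ∧ w p = wMax BWT w c a a'})
    ⟨q, hq, hq', hqc, hqm.symm⟩
  obtain ⟨h1, h2, h3, h4⟩ := hmem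
  refine ⟨h1, h2, h3, by rw [h4]; exact Int.natCast_nonneg _, fun r hr hr' hrc => ⟨?_, fun he => ?_⟩⟩
  · rw [h4]
    by_cases hr0 : 0 ≤ w r
    · have : (w r).toNat ≤ _ := le_csSup hfin.bddAbove ⟨r, hr, hr', hrc, hr0, by omega⟩
      unfold wMax
      omega
    · exact le_trans (by omega) (Int.natCast_nonneg _)
  · exact Nat.sInf_le ⟨hr, hr', hrc, he.trans h4⟩

lemma SASetup.sfx_lex {n σ : ℕ} {T : ℕ → ℤ} {dollar : ℤ} {SA : ℕ → ℕ}
    (h : SASetup n σ T dollar SA) {i j : ℕ} (hi : 1 ≤ i) (hij : i ≤ j) (hj : j ≤ n) :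
    sfx (Trev T n) n (SA i) = sfx (Trev T n) n (SA j) ∨
      List.Lex (· < ·) (sfx (Trev T n) n (SA i)) (sfx (Trev T n) n (SA j)) := by
  rcases hij.eq_or_lt with rfl | hlt
  · exact Or.inl rfl
  · exact Or.inr (h.hSAord i j hi hlt hj)

lemma LCPSetup.prefix_iff_pred {n σ : ℕ} {T : ℕ → ℤ} {dollar : ℤ} {SA : ℕ → ℕ} {LCP : ℕ → ℤ}
    (h : LCPSetup n σ T dollar SA LCP) {v : List ℤ} {i : ℕ} (hi : 1 < i) (hin : i ≤ n)
    (hv : (v.length : ℤ) ≤ LCP i) :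
    v <+: sfx (Trev T n) n (SA (i - 1)) ↔ v <+: sfx (Trev T n) n (SA i) := by
  rw [h.hLCP i hi hin] at hv
  obtain ⟨u, hu, h1, h2⟩ :=
    lcpLen_spec (sfx (Trev T n) n (SA (i - 1))) (sfx (Trev T n) n (SA i))
  exact ⟨fun hp => (List.prefix_of_prefix_length_le hp h1 (by omega)).trans h2,
    fun hp => (List.prefix_of_prefix_length_le hp h2 (by omega)).trans h1⟩

/-- The indices in `[b(x), e(x))` are those of the suffixes sharing their first `LCP[x]`
characters with the suffixes at `x - 1` and `x`. -/
lemma LCPSetup.exists_prefix_iff_mem_interval {n σ : ℕ} {T : ℕ → ℤ} {dollar : ℤ} {SA : ℕ → ℕ}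
    {LCP : ℕ → ℤ} (h : LCPSetup n σ T dollar SA LCP) {x : ℕ} (hx : 1 < x) (hxn : x ≤ n) :
    ∃ v : List ℤ, v <+: sfx (Trev T n) n (SA (x - 1)) ∧ v <+: sfx (Trev T n) n (SA x) ∧
      ∀ p, 1 ≤ p → p ≤ n →
        (v <+: sfx (Trev T n) n (SA p) ↔ bIdx LCP x ≤ p ∧ p < eIdx LCP n x) := by
  obtain ⟨v, hv, hv1, hv2⟩ :=
    lcpLen_spec (sfx (Trev T n) n (SA (x - 1))) (sfx (Trev T n) n (SA x))
  have hL : (v.length : ℤ) = LCP x := by rw [h.hLCP x hx hxn, hv]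
  obtain ⟨hb1, hbx, hbL, hb⟩ := bIdx_spec LCP hx (by rw [h.hLCP1]; omega)
  obtain ⟨hex, hen, heL, he⟩ := eIdx_spec LCP hxn
  have between : ∀ {i j k}, 1 ≤ i → i ≤ j → j ≤ k → k ≤ n → v <+: sfx (Trev T n) n (SA i) →
      v <+: sfx (Trev T n) n (SA k) → v <+: sfx (Trev T n) n (SA j) := fun hi hij hjk hk =>
    prefix_of_lex_between (h.toSASetup.sfx_lex hi hij (hjk.trans hk))
      (h.toSASetup.sfx_lex (hi.trans hij) hjk hk)
  have le_LCP : ∀ {i}, 1 < i → i ≤ n → v <+: sfx (Trev T n) n (SA (i - 1)) →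
      v <+: sfx (Trev T n) n (SA i) → LCP x ≤ LCP i := fun hi hin h1 h2 => by
    rw [← hL, h.hLCP _ hi hin]
    exact_mod_cast length_le_lcpLen h1 h2
  refine ⟨v, hv1, hv2, fun p hp1 hpn => ⟨fun hp => ⟨?_, ?_⟩, fun hp => ?_⟩⟩
  · by_contra! hlt
    have := le_LCP (i := bIdx LCP x) (by omega) (by omega)
      (between hp1 (by omega) (by omega) hxn hp hv2) (between hp1 hlt.le hbx.le hxn hp hv2)
    omega
  · by_contra! hle
    have := le_LCP (i := eIdx LCP n x) (by omega) (by omega)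
      (between hx.le (by omega) (by omega) hpn hv2 hp) (between hx.le hex.le hle hpn hv2 hp)
    have := heL (by omega)
    omega
  · obtain ⟨hbp, hpe⟩ := hp
    rcases le_total x p with hxp | hpx
    · obtain ⟨d, rfl⟩ := Nat.exists_eq_add_of_le hxp
      clear hp1 hbp hxp
      induction d with
      | zero => exact hv2
      | succ d ih =>
        exact (h.prefix_iff_pred (i := x + d + 1) (by omega) hpn
          (hL.le.trans (he _ (by omega) hpe))).1 (ih (by omega) (by omega))
    · obtain ⟨d, hd⟩ := Nat.exists_eq_add_of_le hpx
      clear hpn hpe hpx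
      induction d generalizing p with
      | zero => rwa [show p = x by omega]
      | succ d ih =>
        refine (h.prefix_iff_pred (i := p + 1) (by omega) (by omega) ?_).2
          (ih (p + 1) (by omega) (by omega) (by omega))
        rcases (show p + 1 ≤ x by omega).eq_or_lt with hpx | hpx
        · rw [hL, hpx]
        · exact hL.le.trans (hb _ (by omega) hpx)

lemma TextSetup.notMem_seg {n σ : ℕ} {T : ℕ → ℤ} {dollar : ℤ} (h : TextSetup n σ T dollar)
    {N : ℕ} (hN : N < n) : T n ∉ seg T 1 N := by
  simp only [seg, List.mem_map, List.mem_range, not_exists, not_and]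
  intro k hk
  rw [h.hTn]
  exact h.hTne _ (by omega) (by omega)

/-- At a run start `x`, the interval `[b(x), e(x))` consists of the indices whose text prefix ends
with a right-maximal string `u`. -/
lemma FullSetup.exists_rightMax_suffix_iff {n σ : ℕ} {T : ℕ → ℤ} {dollar : ℤ} {SA : ℕ → ℕ}
    {BWT LCP w : ℕ → ℤ} (h : FullSetup n σ T dollar SA BWT LCP w) {x : ℕ} (hx : 1 < x)
    (hxn : x ≤ n) (hrun : BWT x ≠ BWT (x - 1)) :
    ∃ u : List ℤ, RightMax T n σ u ∧ ∀ p, 1 ≤ p → p ≤ n →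
      (u <:+ seg T 1 (n - SA p) ↔ bIdx LCP x ≤ p ∧ p < eIdx LCP n x) := by
  obtain ⟨v, hv1, hv2, hv⟩ := h.toLCPSetup.exists_prefix_iff_mem_interval hx hxn
  have hlt : ∀ p, 1 ≤ p → p ≤ n → n - SA p < n := fun p hp hpn => by
    have := h.hSAmem p hp hpn
    omega
  have hrow : ∀ p, 1 ≤ p → p ≤ n →
      sfx (Trev T n) n (SA p) = (seg T 1 (n - SA p)).reverse ++ [T n] := fun p hp hpn =>
    sfx_Trev T (h.hSAmem p hp hpn).2
  have hnd : ∀ p, 1 ≤ p → p ≤ n → T n ∉ (seg T 1 (n - SA p)).reverse := fun p hp hpn => by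
    simpa using h.toTextSetup.notMem_seg (hlt p hp hpn)
  have hvx : v <+: (seg T 1 (n - SA x)).reverse := by
    rw [hrow _ (by omega) hxn] at hv2
    rw [hrow _ (by omega) (by omega)] at hv1
    refine prefix_left_of_prefix_concat hv2 hv1 (hnd _ (by omega) (by omega)) fun heq => ?_
    have hl := congrArg List.length heq
    simp only [List.length_reverse, seg_length] at hl
    have h1 := h.hSAmem x (by omega) hxn
    have h2 := h.hSAmem (x - 1) (by omega) (by omega)
    have := h.hSAinj x (x - 1) (by omega) hxn (by omega) (by omega) (by omega)
    omega
  have key : ∀ p, 1 ≤ p → p ≤ n →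
      (v.reverse <:+ seg T 1 (n - SA p) ↔ v <+: sfx (Trev T n) n (SA p)) := fun p hp hpn => by
    rw [← List.reverse_prefix, List.reverse_reverse, hrow p hp hpn, List.prefix_concat_iff]
    refine ⟨Or.inr, fun h' => h'.resolve_left fun heq => hnd x (by omega) hxn ?_⟩
    exact hvx.subset (by simp [heq])
  have hocc : ∀ p, 1 ≤ p → p ≤ n → v <+: sfx (Trev T n) n (SA p) →
      1 ≤ BWT p ∧ BWT p ≤ σ ∧ OccursIn T n (v.reverse ++ [BWT p]) := fun p hp hpn hvp => by
    have := hlt p hp hpn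
    rw [h.hBWT p hp hpn]
    obtain ⟨hT1, hT2⟩ := h.hT (n - SA p + 1) (by omega) (by omega)
    exact ⟨hT1, hT2, OccursIn_of_suffix this ((key p hp hpn).2 hvp)⟩
  refine ⟨v.reverse, ?_, fun p hp hpn => (key p hp hpn).trans (hv p hp hpn)⟩
  obtain ⟨a1, a2, a3⟩ := hocc x (by omega) hxn hv2
  obtain ⟨b1, b2, b3⟩ := hocc (x - 1) (by omega) (by omega) hv1
  exact ⟨_, _, hrun, a1, a2, b1, b2, a3, b3⟩

/-- If the string of length `w(ℓ)` preceding the candidate `ℓ := Candt_c(b(x), e(x))` also precedes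
`q`, then `q` lies in `[b(x), e(x))`, so it does not beat `ℓ` as a candidate. -/
lemma FullSetup.le_weight_of_suffix {n σ : ℕ} {T : ℕ → ℤ} {dollar : ℤ} {SA : ℕ → ℕ}
    {BWT LCP w : ℕ → ℤ} (h : FullSetup n σ T dollar SA BWT LCP w) {x : ℕ} (hx : 1 < x)
    (hxn : x ≤ n) (hrun : BWT x ≠ BWT (x - 1)) {c : ℤ} {l : ℕ}
    (hl : (l : ℤ) = Candt BWT w c (bIdx LCP x) (eIdx LCP n x)) :
    1 ≤ l ∧ l ≤ n ∧ BWT l = c ∧ 0 ≤ w l ∧ (w l).toNat ≤ n - SA l ∧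
      ∀ q, 1 ≤ q → q ≤ n → BWT q = c →
        seg T (n - SA l + 1 - (w l).toNat) (w l).toNat <:+ seg T 1 (n - SA q) →
          w q ≤ w l ∧ (w q = w l → l ≤ q) := by
  obtain ⟨hbl, hle, hlc, hwl, hmax⟩ := Candt_spec hl
  have hb1 := (bIdx_spec LCP hx (by rw [h.hLCP1, h.hLCP x hx hxn]; omega)).1
  have hen := (eIdx_spec LCP hxn).2.1
  have hl1 : 1 ≤ l := by omega
  have hln : l ≤ n := by omega
  obtain ⟨u, hu, hiff⟩ := h.exists_rightMax_suffix_iff hx hxn hrun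
  have hul := (hiff l hl1 hln).2 ⟨hbl, hle⟩
  have hrb : RunBoundary BWT n l := by
    by_contra hrb
    have := h.hwNot l hl1 hln hrb
    omega
  obtain ⟨⟨s, -, hs, hsw⟩, hub⟩ := h.hwRB l hl1 hln hrb ⟨u, hu, hul⟩
  have huw : (u.length : ℤ) ≤ w l := hub ⟨u, hu, hul, rfl⟩
  have hsl : s.length ≤ n - SA l := by simpa [seg_length] using hs.length_le
  have hwn : (w l).toNat ≤ n - SA l := by omega
  refine ⟨hl1, hln, hlc, hwl, hwn, fun q hq hqn hqc hsq => ?_⟩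
  have huq := (List.suffix_of_suffix_length_le hul (seg_suffix T hwn)
    (by rw [seg_length]; omega)).trans hsq
  obtain ⟨hbq, hqe⟩ := (hiff q hq hqn).1 huq
  exact hmax q hbq hqe hqc

/-- For `ℓ := Candt_c(b(x), e(x))` and `ℓ' := Candt_{c'}(b(x'), e(x'))` as in the
paper, if `ℓ ≠ ℓ'` and `w(ℓ) ≤ w(ℓ')`, then `T[n-SA[ℓ]+1-w(ℓ)..n-SA[ℓ]+1]` is not a suffix of
`T[n-SA[ℓ']+1-w(ℓ')..n-SA[ℓ']+1]`. -/
theorem stmt6 (n σ : ℕ) (T : ℕ → ℤ) (dollar : ℤ) (SA : ℕ → ℕ) (BWT LCP w : ℕ → ℤ)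
    (hsetup : FullSetup n σ T dollar SA BWT LCP w)
    (x x' : ℕ) (hx1 : 1 < x) (hxn : x ≤ n) (hx'1 : 1 < x') (hx'n : x' ≤ n)
    (hrun : BWT x ≠ BWT (x - 1)) (hrun' : BWT x' ≠ BWT (x' - 1))
    (c c' : ℤ) (hc : c = BWT x ∨ c = BWT (x - 1)) (hc' : c' = BWT x' ∨ c' = BWT (x' - 1))
    (l l' : ℕ)
    (hl : (l : ℤ) = Candt BWT w c (bIdx LCP x) (eIdx LCP n x))
    (hl' : (l' : ℤ) = Candt BWT w c' (bIdx LCP x') (eIdx LCP n x'))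
    (hne : l ≠ l') (hw : w l ≤ w l') :
    ¬ (seg T (n - SA l + 1 - (w l).toNat) ((w l).toNat + 1) <:+
        seg T (n - SA l' + 1 - (w l').toNat) ((w l').toNat + 1)) := by
  intro hsuf
  obtain ⟨hl1, hln, hlc, hwl, hwn, hmax⟩ := hsetup.le_weight_of_suffix hx1 hxn hrun hl
  obtain ⟨hl'1, hl'n, hl'c, hwl', hwn', hmax'⟩ :=
    hsetup.le_weight_of_suffix hx'1 hx'n hrun' hl'
  rw [seg_succ, seg_succ] at hsuf
  obtain ⟨hlast, hsuf⟩ := concat_suffix_concat hsuf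
  rw [show n - SA l + 1 - (w l).toNat + (w l).toNat = n - SA l + 1 by omega,
    show n - SA l' + 1 - (w l').toNat + (w l').toNat = n - SA l' + 1 by omega,
    ← hsetup.hBWT l hl1 hln, ← hsetup.hBWT l' hl'1 hl'n] at hlast
  obtain ⟨hle, hmin⟩ := hmax l' hl'1 hl'n (by rw [← hlast, hlc])
    (hsuf.trans (seg_suffix T hwn'))
  have hweq : w l' = w l := le_antisymm hle hw
  have hseg := hsuf.eq_of_length (by rw [seg_length, seg_length, hweq])
  have hmin' := (hmax' l hl1 hln (by rw [hlast, hl'c])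
    (hseg ▸ seg_suffix T hwn)).2 hweq.symm
  exact hne (le_antisymm (hmin hweq) hmin')
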